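/- Almost surely every site is eventually gentle. Let Γ, γ be moderately steep scales with parameters a > 0 and ε ∈ (0,1), let Q be a probability measure on {0,1}^{ℤ^d} satisfying the decay condition (smin) with constants b'', B'', assume p = sup_x Q(ω_x = 1) ≤ exp{−a/(1−ε)}, and assume condition (gag): 2·9^d·B''·θ_{k+1}^{2d}·exp{−b''Γ_{k+1}/20} ≤ exp{−a(1+ε)^{k+1}/(1−ε)} for all k ≥ 0. Then Q(ω : ⋂_{k≥0} B_k(ω) = ∅) = 1; equivalently, Q-almost surely every x ∈ ℤ^d belongs to G_j(ω) for some j ≥ 0, so that ⋃_{j≥0} 𝒢_j(ω) is a partition of ℤ^d. -/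

import Mathlib

namespace Paper

open MeasureTheory

noncomputable section

/-- The lattice `ℤ^d`. -/
abbrev ZLat (d : ℕ) := Fin d → ℤ

/-- A disorder configuration `ω ∈ {0,1}^{ℤ^d}` (`true` = bad site). -/
abbrev DConf (d : ℕ) := ZLat d → Bool

/-- The `ℓ¹` distance on `ℤ^d`. -/
def D1 {d : ℕ} (x y : ZLat d) : ℕ := ∑ i, (x i - y i).natAbs

/-- The sup distance on `ℤ^d`. -/
def supD {d : ℕ} (x y : ZLat d) : ℕ := Finset.univ.sup fun i => (x i - y i).natAbs

/-- The `ℓ¹` ball `O_r(x)` of (real) radius `r` around `x`. -/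
def ball1 {d : ℕ} (x : ZLat d) (r : ℝ) : Set (ZLat d) := {y | (D1 x y : ℝ) ≤ r}

/-- The `ℓ¹` neighborhood `O_r(X)` of a set `X`. -/
def nbd1 {d : ℕ} (X : Set (ZLat d)) (r : ℝ) : Set (ZLat d) :=
  {y | ∃ x ∈ X, (D1 x y : ℝ) ≤ r}

/-- The σ-algebra `𝒜_Λ` generated by the coordinates in `Λ`. -/
def cylSigma {d : ℕ} (Λ : Set (ZLat d)) : MeasurableSpace (DConf d) :=
  MeasurableSpace.comap (fun ω => fun x : Λ => ω x) inferInstance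

/-- `f` is a local function with support contained in the finite set `S`. -/
def LocalOn {d : ℕ} (f : DConf d → ℝ) (S : Finset (ZLat d)) : Prop :=
  ∀ σ τ : DConf d, (∀ x ∈ S, σ x = τ x) → f σ = f τ

/-- Sup norm of a real valued function. -/
def supNorm {α : Type*} (f : α → ℝ) : ℝ := ⨆ a, |f a|

/-- The `ℓ¹` distance between two finite subsets of the lattice. -/
def fDist1 {d : ℕ} (A B : Finset (ZLat d)) : ℝ :=
  sInf ((fun p : ZLat d × ZLat d => (D1 p.1 p.2 : ℝ)) '' {p | p.1 ∈ A ∧ p.2 ∈ B})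

/-- The decay condition (smin): exponential decay of correlations of `Q`. -/
def Smin {d : ℕ} (Q : Measure (DConf d)) (b'' B'' : ℝ) : Prop :=
  ∀ (f g : DConf d → ℝ) (Sf Sg : Finset (ZLat d)),
    LocalOn f Sf → LocalOn g Sg →
    (min Sf.card Sg.card : ℝ) * Real.exp (-b'' * fDist1 Sf Sg) ≤ 1 →
    |(∫ ω, f ω * g ω ∂Q) - (∫ ω, f ω ∂Q) * ∫ ω, g ω ∂Q| ≤
      B'' * supNorm f * supNorm g * (min Sf.card Sg.card : ℝ) *
        Real.exp (-b'' * fDist1 Sf Sg)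

/-- `θ_j = ∑_{i=0}^{j} (Γ_i + γ_i)`. -/
def theta (Γ γ : ℕ → ℝ) (j : ℕ) : ℝ := ∑ i ∈ Finset.range (j + 1), (Γ i + γ i)

/-- Moderately steep scales, with parameters `a > 0` and `ε ∈ (0,1)`
(items (1)–(5) of the definition). -/
structure ModSteep (d : ℕ) (Γ γ : ℕ → ℝ) (a ε : ℝ) : Prop where
  gammaBigMono : StrictMono Γ
  gammaSmallMono : StrictMono γ
  gammaBigZero : Γ 0 = 0
  gammaSmallZero : 0 ≤ γ 0
  gammaBigOne : 2 ≤ Γ 1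
  halfLt : ∀ j : ℕ, 1 ≤ j → Γ j < γ j / 2
  lam : ∀ j : ℕ, 10 * theta Γ γ j ≤ Γ (j + 1)
  covolSummable : Summable (fun j : ℕ => if j = 0 then (0 : ℝ) else Γ j / γ j)
  covol : (∑' j : ℕ, if j = 0 then (0 : ℝ) else Γ j / γ j) ≤ 1 / 2
  apos : 0 < a
  epsMem : ε ∈ Set.Ioo (0 : ℝ) 1
  growth : ∀ k : ℕ, 2 * 3 ^ d * theta Γ γ (k + 1) ^ d ≤ Real.exp (a * (1 + ε) ^ k)
  tail : ∀ s : ℝ, 0 ≤ s → ∀ q : ℝ, 1 < q →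
    Summable fun k : ℕ => theta Γ γ k ^ s * Real.exp (-a * (1 + ε) ^ k / q)

/-- `x` is a gentle point at level `k ≥ 1` with respect to the set `Bprev` of
`(k-1)`-bad points: `x ∈ Bprev`, the atom `A = O_{Γ_k}(x) ∩ Bprev` has `ℓ¹` diameter
at most `Γ_k`, and `D(A, Bprev ∖ A) > γ_k`. -/
def gentleOn {d : ℕ} (Γ γ : ℕ → ℝ) (Bprev : Set (ZLat d)) (k : ℕ) (x : ZLat d) : Prop :=
  x ∈ Bprev ∧
  (∀ u ∈ ball1 x (Γ k) ∩ Bprev, ∀ v ∈ ball1 x (Γ k) ∩ Bprev, (D1 u v : ℝ) ≤ Γ k) ∧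
  (∀ u ∈ ball1 x (Γ k) ∩ Bprev, ∀ v ∈ Bprev \ (ball1 x (Γ k) ∩ Bprev),
    γ k < (D1 u v : ℝ))

/-- The recursive classification of badness: `B_0(ω) = {x : ω_x = 1}` and
`B_k(ω) = B_{k-1}(ω)` minus the `k`-gentle points. -/
def badSet {d : ℕ} (Γ γ : ℕ → ℝ) (ω : DConf d) : ℕ → Set (ZLat d)
  | 0 => {x | ω x = true}
  | k + 1 => {x | x ∈ badSet Γ γ ω k ∧ ¬ gentleOn Γ γ (badSet Γ γ ω k) (k + 1) x}

/-- The `k`-gentle sites: `G_0(ω) = {x : ω_x = 0}`, `G_k(ω) = B_{k-1}(ω) ∖ B_k(ω)`. -/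
def gentleSet {d : ℕ} (Γ γ : ℕ → ℝ) (ω : DConf d) : ℕ → Set (ZLat d)
  | 0 => {x | ω x = false}
  | k + 1 => badSet Γ γ ω k \ badSet Γ γ ω (k + 1)

/-- The collection of `k`-gentle atoms `𝒢_k(ω)` (for `k ≥ 1`):
`A = O_{Γ_k}(x) ∩ B_{k-1}(ω)` for `x` a `k`-gentle point. -/
def atomsAt {d : ℕ} (Γ γ : ℕ → ℝ) (ω : DConf d) (k : ℕ) : Set (Set (ZLat d)) :=
  {A | ∃ x : ZLat d, gentleOn Γ γ (badSet Γ γ ω (k - 1)) k x ∧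
        A = ball1 x (Γ k) ∩ badSet Γ γ ω (k - 1)}

/-- The smallest coordinate parallelepiped `Env(g)` containing `g`. -/
def env {d : ℕ} (g : Set (ZLat d)) : Set (ZLat d) :=
  {x | ∀ i : Fin d, (∃ u ∈ g, u i ≤ x i) ∧ ∃ v ∈ g, x i ≤ v i}

/-- The residual bad sets of a graded family of atoms:
`B_0 = 𝕃 ∖ G_0`, `B_j = B_{j-1} ∖ ⋃(atoms of grade j)`. -/
def Bres {d : ℕ} (G0 : Set (ZLat d)) (atoms : ℕ → Set (Set (ZLat d))) : ℕ → Set (ZLat d)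
  | 0 => G0ᶜ
  | k + 1 => Bres G0 atoms k \ ⋃ g ∈ atoms (k + 1), g

/-- A gentle disintegration of `ℤ^d` with respect to `G0` and the scales `Γ, γ`. -/
structure GentleDisintegration (d : ℕ) (G0 : Set (ZLat d)) (Γ γ : ℕ → ℝ) where
  atoms : ℕ → Set (Set (ZLat d))
  atomFinite : ∀ j, ∀ g ∈ atoms j, g.Finite
  atomNonempty : ∀ j, ∀ g ∈ atoms j, g.Nonempty
  uniqueGrade : ∀ j j' g, g ∈ atoms j → g ∈ atoms j' → j = j'
  pairwiseDisjoint : ∀ j j' g g', g ∈ atoms j → g' ∈ atoms j' → g ≠ g' → Disjoint g g'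
  cover : ∀ x : ZLat d, ∃ j, ∃ g ∈ atoms j, x ∈ g
  grade0 : atoms 0 = {s | ∃ x ∈ G0, s = {x}}
  subsBad : ∀ j, ∀ g ∈ atoms (j + 1), g ⊆ Bres G0 atoms j
  diamBound : ∀ j, 1 ≤ j → ∀ g ∈ atoms j, ∀ u ∈ g, ∀ v ∈ g, (D1 u v : ℝ) ≤ Γ j
  separation : ∀ j, ∀ g ∈ atoms (j + 1), ∀ u ∈ g, ∀ v ∈ Bres G0 atoms j \ g,
    γ (j + 1) < (D1 u v : ℝ)
  horizon : ∀ x : ZLat d,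
    {j : ℕ | 1 ≤ j ∧ ∃ g ∈ atoms j, ∃ y ∈ env g, (supD x y : ℝ) ≤ theta Γ γ j}.Finite


section Locality

variable {d : ℕ}

lemma D1_comm (x y : ZLat d) : D1 x y = D1 y x := by
  unfold D1
  exact Finset.sum_congr rfl fun i _ => by omega

lemma D1_triangle (x y z : ZLat d) : D1 x z ≤ D1 x y + D1 y z := by
  unfold D1
  rw [← Finset.sum_add_distrib]
  exact Finset.sum_le_sum fun i _ => by omega

lemma D1_triangle_real (x y z : ZLat d) : (D1 x z : ℝ) ≤ D1 x y + D1 y z := by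
  exact_mod_cast D1_triangle x y z

/-- The `ℓ¹` ball of radius `r` as a finite set. -/
def ballFin (x : ZLat d) (r : ℝ) : Finset (ZLat d) :=
  (Finset.Icc (fun i => x i - ⌊r⌋₊) (fun i => x i + ⌊r⌋₊)).filter fun y => D1 x y ≤ ⌊r⌋₊

lemma mem_ballFin {x y : ZLat d} {r : ℝ} (hr : 0 ≤ r) : y ∈ ballFin x r ↔ (D1 x y : ℝ) ≤ r := by
  rw [← Nat.le_floor_iff hr]
  simp only [ballFin, Finset.mem_filter, and_iff_right_iff_imp, Finset.mem_Icc]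
  intro h
  have h1 : ∀ i, (x i - y i).natAbs ≤ ⌊r⌋₊ := fun i =>
    (Finset.single_le_sum (f := fun i => (x i - y i).natAbs) (fun _ _ => Nat.zero_le _)
      (Finset.mem_univ i)).trans h
  exact ⟨fun i => by have := h1 i; dsimp only; omega, fun i => by have := h1 i; dsimp only; omega⟩

lemma card_ballFin_le (x : ZLat d) {r : ℝ} (hr : 0 ≤ r) :
    ((ballFin x r).card : ℝ) ≤ (2 * r + 1) ^ d := by
  have h1 : (ballFin x r).card ≤ (2 * ⌊r⌋₊ + 1) ^ d := by
    refine (Finset.card_filter_le _ _).trans (le_of_eq ?_)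
    rw [Pi.card_Icc]
    simp only [Int.card_Icc]
    rw [Finset.prod_congr rfl (g := fun _ => 2 * ⌊r⌋₊ + 1) fun i _ => by omega]
    simp
  calc ((ballFin x r).card : ℝ) ≤ (2 * (⌊r⌋₊ : ℝ) + 1) ^ d := by exact_mod_cast h1
    _ ≤ (2 * r + 1) ^ d := by gcongr; exact Nat.floor_le hr

/-- The event `E` depends only on the coordinates in `S`. -/
def EventOn (E : Set (DConf d)) (S : Finset (ZLat d)) : Prop :=
  ∀ σ τ : DConf d, (∀ x ∈ S, σ x = τ x) → σ ∈ E → τ ∈ E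

lemma LocalOn.measurable {f : DConf d → ℝ} {S : Finset (ZLat d)} (hf : LocalOn f S) :
    Measurable f := by
  classical
  have h : f = (fun r : S → Bool => f fun x => if h : x ∈ S then r ⟨x, h⟩ else false) ∘
      fun (ω : DConf d) (x : S) => ω x := by
    funext ω
    refine hf _ _ fun x hx => ?_
    simp [hx]
  rw [h]
  exact (measurable_of_finite _).comp (measurable_pi_lambda _ fun x => measurable_pi_apply _)

lemma LocalOn.integrable {f : DConf d → ℝ} {S : Finset (ZLat d)} (hf : LocalOn f S)
    (Q : Measure (DConf d)) [IsProbabilityMeasure Q] {c : ℝ} (hc : ∀ ω, |f ω| ≤ c) :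
    Integrable f Q :=
  Integrable.of_bound hf.measurable.aestronglyMeasurable c (Filter.Eventually.of_forall hc)

lemma LocalOn.mono {f : DConf d → ℝ} {S T : Finset (ZLat d)} (hf : LocalOn f S) (h : S ⊆ T) :
    LocalOn f T :=
  fun σ τ hστ => hf σ τ fun x hx => hστ x (h hx)

lemma LocalOn.mul {f g : DConf d → ℝ} {S : Finset (ZLat d)} (hf : LocalOn f S)
    (hg : LocalOn g S) : LocalOn (fun ω => f ω * g ω) S :=
  fun σ τ h => by simp only [hf σ τ h, hg σ τ h]

lemma EventOn.localOn_indicator {E : Set (DConf d)} {S : Finset (ZLat d)} (hE : EventOn E S) :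
    LocalOn (E.indicator 1) S := by
  classical
  intro σ τ h
  have : σ ∈ E ↔ τ ∈ E := ⟨hE σ τ h, hE τ σ fun x hx => (h x hx).symm⟩
  simp [Set.indicator_apply, this]

lemma EventOn.measurableSet {E : Set (DConf d)} {S : Finset (ZLat d)} (hE : EventOn E S) :
    MeasurableSet E := by
  classical
  have h : E = (E.indicator (1 : DConf d → ℝ)) ⁻¹' {1} := by
    ext ω
    by_cases h : ω ∈ E <;> simp [h]
  rw [h]
  exact hE.localOn_indicator.measurable (measurableSet_singleton 1)

end Locality

section Covariance

variable {d : ℕ} {Q : Measure (DConf d)} {b'' B'' : ℝ}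

lemma supNorm_le {α : Type*} [Nonempty α] {f : α → ℝ} {c : ℝ} (h : ∀ a, |f a| ≤ c) :
    supNorm f ≤ c :=
  ciSup_le h

lemma supNorm_nonneg {α : Type*} (f : α → ℝ) : 0 ≤ supNorm f :=
  Real.iSup_nonneg fun _ => abs_nonneg _

lemma fDist1_nonneg (A B : Finset (ZLat d)) : 0 ≤ fDist1 A B := by
  refine Real.sInf_nonneg ?_
  rintro _ ⟨p, _, rfl⟩
  positivity

lemma le_fDist1 {A B : Finset (ZLat d)} (hA : A.Nonempty) (hB : B.Nonempty) {r : ℝ}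
    (h : ∀ u ∈ A, ∀ v ∈ B, r ≤ D1 u v) : r ≤ fDist1 A B := by
  obtain ⟨u, hu⟩ := hA
  obtain ⟨v, hv⟩ := hB
  refine le_csInf ⟨_, (u, v), ⟨hu, hv⟩, rfl⟩ ?_
  rintro _ ⟨p, hp, rfl⟩
  exact h _ hp.1 _ hp.2

/-- Covariance bound from the decay condition when the support of one of the observables is
small compared to the distance of the supports. -/
lemma Smin.covariance_le_of_small (hQ : Smin Q b'' B'') (hb : 0 < b'') (hB : 0 < B'')
    {f g : DConf d → ℝ} {S T : Finset (ZLat d)} (hf : LocalOn f S) (hg : LocalOn g T)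
    (hf1 : ∀ ω, |f ω| ≤ 1) (hg1 : ∀ ω, |g ω| ≤ 1) {M r : ℝ} (hM : (S.card : ℝ) ≤ M)
    (hr : ∀ u ∈ S, ∀ v ∈ T, r ≤ D1 u v) (hMr : M * Real.exp (-b'' * r) ≤ 1) :
    |(∫ ω, f ω * g ω ∂Q) - (∫ ω, f ω ∂Q) * ∫ ω, g ω ∂Q| ≤ B'' * (M * Real.exp (-b'' * r)) := by
  have hM0 : 0 ≤ M := (Nat.cast_nonneg _).trans hM
  have key : (min S.card T.card : ℝ) * Real.exp (-b'' * fDist1 S T) ≤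
      M * Real.exp (-b'' * r) := by
    rcases S.eq_empty_or_nonempty with rfl | hS
    · simp; positivity
    rcases T.eq_empty_or_nonempty with rfl | hT
    · simp; positivity
    have := le_fDist1 hS hT hr
    refine mul_le_mul ((min_le_left _ _).trans hM) (Real.exp_le_exp.2 ?_) (Real.exp_pos _).le hM0
    nlinarith
  refine (hQ f g S T hf hg (key.trans hMr)).trans ?_
  have h0 : 0 ≤ (min S.card T.card : ℝ) * Real.exp (-b'' * fDist1 S T) := by positivity
  have h1 : supNorm f * supNorm g ≤ 1 :=
    mul_le_one₀ (supNorm_le hf1) (supNorm_nonneg _) (supNorm_le hg1)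
  calc B'' * supNorm f * supNorm g * (min S.card T.card : ℝ) * Real.exp (-b'' * fDist1 S T)
      = B'' * ((supNorm f * supNorm g) *
          ((min S.card T.card : ℝ) * Real.exp (-b'' * fDist1 S T))) := by ring
    _ ≤ B'' * (1 * (M * Real.exp (-b'' * r))) := by gcongr
    _ = _ := by ring

variable [IsProbabilityMeasure Q]

/-- Covariance bound obtained by integrating out the sites of the support one at a time. -/
lemma Smin.covariance_le_card (hQ : Smin Q b'' B'') (hb : 0 < b'') (hB : 0 < B'')
    {g : DConf d → ℝ} {T : Finset (ZLat d)} (hg : LocalOn g T) (hg0 : ∀ ω, 0 ≤ g ω)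
    (hg1 : ∀ ω, g ω ≤ 1) (S : Finset (ZLat d)) :
    ∀ f : DConf d → ℝ, LocalOn f S → (∀ ω, 0 ≤ f ω) → (∀ ω, f ω ≤ 1) →
    |(∫ ω, f ω * g ω ∂Q) - (∫ ω, f ω ∂Q) * ∫ ω, g ω ∂Q| ≤ 2 * B'' * S.card := by
  classical
  induction S using Finset.induction_on with
  | empty =>
    intro f hf _ _
    have h : ∀ ω, f ω = f fun _ => false := fun ω => hf _ _ (by simp)
    have h2 : ∫ ω, f ω * g ω ∂Q = (f fun _ => false) * ∫ ω, g ω ∂Q := by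
      rw [← integral_const_mul]
      exact integral_congr_ae (Filter.Eventually.of_forall fun ω => by dsimp only; rw [h ω])
    have h3 : ∫ ω, f ω ∂Q = f fun _ => false := by
      rw [integral_congr_ae (Filter.Eventually.of_forall h)]
      simp
    rw [h2, h3]
    simp
  | insert s S hs ih =>
    intro f hf hf0 hf1
    set F : Bool → DConf d → ℝ := fun c ω => f (Function.update ω s c) with hF
    have hFl : ∀ c, LocalOn (F c) S := by
      intro c σ τ h
      refine hf _ _ fun x hx => ?_
      by_cases hxs : x = s
      · subst hxs; simp
      · simp only [Function.update_of_ne hxs]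
        exact h x (Finset.mem_of_mem_insert_of_ne hx hxs)
    have hF0 : ∀ c ω, 0 ≤ F c ω := fun c ω => hf0 _
    have hF1 : ∀ c ω, F c ω ≤ 1 := fun c ω => hf1 _
    set e : DConf d → ℝ := {ω : DConf d | ω s = true}.indicator 1 with he
    have hel : LocalOn e {s} := by
      refine EventOn.localOn_indicator fun σ τ h hσ => ?_
      have := h s (by simp)
      simpa [← this] using hσ
    have he01 : ∀ ω, e ω = 0 ∨ e ω = 1 := by
      intro ω
      by_cases h : ω s = true <;> simp [he, h]
    have he0 : ∀ ω, 0 ≤ e ω := fun ω => by rcases he01 ω with h | h <;> simp [h]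
    have he1 : ∀ ω, e ω ≤ 1 := fun ω => by rcases he01 ω with h | h <;> simp [h]
    have hea : ∀ ω, |e ω| ≤ 1 := fun ω => by rw [abs_of_nonneg (he0 ω)]; exact he1 ω
    have hdec : ∀ ω, f ω = F false ω + e ω * (F true ω - F false ω) := by
      intro ω
      cases h : ω s
      · have : e ω = 0 := by simp [he, h]
        simp only [hF, this, ← h, Function.update_eq_self]; ring
      · have : e ω = 1 := by simp [he, h]
        simp only [hF, this, ← h, Function.update_eq_self]; ring
    set p : ℝ := ∫ ω, e ω ∂Q with hp
    have hp0 : 0 ≤ p := integral_nonneg he0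
    have hp1 : p ≤ 1 := by
      have := integral_mono (hel.integrable Q hea) (integrable_const (1 : ℝ)) he1
      simpa using this
    have hDl : LocalOn (fun ω => F true ω - F false ω) S := fun σ τ h => by
      simp only [hFl _ σ τ h]
    have hDa : ∀ ω, |F true ω - F false ω| ≤ 1 := fun ω => by
      rw [abs_le]
      constructor <;> linarith [hF0 true ω, hF0 false ω, hF1 true ω, hF1 false ω]
    -- integrating out the site `s` against a test function `h`
    have step : ∀ (h : DConf d → ℝ) (R : Finset (ZLat d)), LocalOn h R → (∀ ω, |h ω| ≤ 1) →
        |(∫ ω, f ω * h ω ∂Q) - ∫ ω, (F false ω + p * (F true ω - F false ω)) * h ω ∂Q| ≤ B'' := by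
      intro h R hh hh1
      have hDh : LocalOn (fun ω => (F true ω - F false ω) * h ω) (S ∪ R) :=
        (hDl.mono Finset.subset_union_left).mul (hh.mono Finset.subset_union_right)
      have hDh1 : ∀ ω, |(F true ω - F false ω) * h ω| ≤ 1 := fun ω => by
        rw [abs_mul]
        exact mul_le_one₀ (hDa ω) (abs_nonneg _) (hh1 ω)
      have hFh : LocalOn (fun ω => F false ω * h ω) (S ∪ R) :=
        ((hFl _).mono Finset.subset_union_left).mul (hh.mono Finset.subset_union_right)
      have hFh1 : ∀ ω, |F false ω * h ω| ≤ 1 := fun ω => by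
        rw [abs_mul]
        exact mul_le_one₀ (by rw [abs_of_nonneg (hF0 _ ω)]; exact hF1 _ ω) (abs_nonneg _) (hh1 ω)
      have heDh : LocalOn (fun ω => e ω * ((F true ω - F false ω) * h ω)) ({s} ∪ (S ∪ R)) :=
        (hel.mono Finset.subset_union_left).mul (hDh.mono Finset.subset_union_right)
      have heDh1 : ∀ ω, |e ω * ((F true ω - F false ω) * h ω)| ≤ 1 := fun ω => by
        rw [abs_mul]
        exact mul_le_one₀ (hea ω) (abs_nonneg _) (hDh1 ω)
      have e1 : ∫ ω, f ω * h ω ∂Q = (∫ ω, F false ω * h ω ∂Q) +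
          ∫ ω, e ω * ((F true ω - F false ω) * h ω) ∂Q := by
        rw [← integral_add (hFh.integrable Q hFh1) (heDh.integrable Q heDh1)]
        refine integral_congr_ae (Filter.Eventually.of_forall fun ω => ?_)
        dsimp only
        rw [hdec ω]; ring
      have e2 : ∫ ω, (F false ω + p * (F true ω - F false ω)) * h ω ∂Q =
          (∫ ω, F false ω * h ω ∂Q) + p * ∫ ω, (F true ω - F false ω) * h ω ∂Q := by
        rw [← integral_const_mul,
          ← integral_add (hFh.integrable Q hFh1) ((hDh.integrable Q hDh1).const_mul p)]
        refine integral_congr_ae (Filter.Eventually.of_forall fun ω => ?_)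
        dsimp only
        ring
      have := hQ.covariance_le_of_small hb hB hel hDh hea hDh1 (M := 1) (r := 0) (by simp)
        (fun _ _ _ _ => by positivity) (by simp)
      rw [e1, e2, add_sub_add_left_eq_sub]
      simpa using this
    have hga : ∀ ω, |g ω| ≤ 1 := fun ω => by rw [abs_of_nonneg (hg0 ω)]; exact hg1 ω
    have s1 := step g T hg hga
    have s2 := step (fun _ => 1) ∅ (fun _ _ _ => rfl) (by simp)
    have s3 := ih (fun ω => F false ω + p * (F true ω - F false ω))
      (fun σ τ h => by simp only [hFl _ σ τ h])
      (fun ω => by nlinarith [hF0 true ω, hF0 false ω, hF1 true ω, hF1 false ω])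
      (fun ω => by nlinarith [hF0 true ω, hF0 false ω, hF1 true ω, hF1 false ω])
    simp only [mul_one] at s2
    have hG0 : 0 ≤ ∫ ω, g ω ∂Q := integral_nonneg hg0
    have hG1 : ∫ ω, g ω ∂Q ≤ 1 := by
      have := integral_mono (hg.integrable Q hga) (integrable_const (1 : ℝ)) hg1
      simpa using this
    rw [Finset.card_insert_of_notMem hs]
    push_cast
    rw [abs_le] at s1 s2 s3 ⊢
    constructor <;> nlinarith

/-- The two covariance bounds combined, for events. -/
lemma Smin.real_inter_le (hQ : Smin Q b'' B'') (hb : 0 < b'') (hB : 0 < B'')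
    {E F : Set (DConf d)} {S T : Finset (ZLat d)} (hE : EventOn E S) (hF : EventOn F T)
    {M r : ℝ} (hM : (S.card : ℝ) ≤ M) (hr : ∀ u ∈ S, ∀ v ∈ T, r ≤ D1 u v) :
    Q.real (E ∩ F) ≤ Q.real E * Q.real F +
      if M * Real.exp (-b'' * r) ≤ 1 then B'' * (M * Real.exp (-b'' * r)) else 2 * B'' * M := by
  classical
  have h0 : ∀ (A : Set (DConf d)) ω, 0 ≤ A.indicator (1 : DConf d → ℝ) ω := fun A ω =>
    Set.indicator_nonneg (fun _ _ => zero_le_one) ω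
  have h1 : ∀ (A : Set (DConf d)) ω, A.indicator (1 : DConf d → ℝ) ω ≤ 1 := fun A ω =>
    Set.indicator_le' (fun _ _ => le_rfl) (fun _ _ => zero_le_one) ω
  have ha : ∀ (A : Set (DConf d)) ω, |A.indicator (1 : DConf d → ℝ) ω| ≤ 1 := fun A ω => by
    rw [abs_of_nonneg (h0 A ω)]; exact h1 A ω
  have hi : ∫ ω, E.indicator (1 : DConf d → ℝ) ω * F.indicator (1 : DConf d → ℝ) ω ∂Q =
      Q.real (E ∩ F) := by
    rw [← integral_indicator_one (hE.measurableSet.inter hF.measurableSet)]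
    refine integral_congr_ae (Filter.Eventually.of_forall fun ω => ?_)
    by_cases h : ω ∈ E <;> by_cases h' : ω ∈ F <;> simp [h, h']
  have hcov : |Q.real (E ∩ F) - Q.real E * Q.real F| ≤
      if M * Real.exp (-b'' * r) ≤ 1 then B'' * (M * Real.exp (-b'' * r)) else 2 * B'' * M := by
    rw [← hi, ← integral_indicator_one hE.measurableSet, ← integral_indicator_one hF.measurableSet]
    split_ifs with h
    · exact hQ.covariance_le_of_small hb hB hE.localOn_indicator hF.localOn_indicator (ha _) (ha _)
        hM hr h
    · refine (hQ.covariance_le_card hb hB hF.localOn_indicator (h0 _) (h1 _) S _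
        hE.localOn_indicator (h0 _) (h1 _)).trans ?_
      gcongr
  linarith [(abs_le.1 hcov).2]

end Covariance

section BadSets

variable {d : ℕ} {Γ γ : ℕ → ℝ} {a ε : ℝ}

lemma gentleOn.congr {B B' : Set (ZLat d)} {k : ℕ} {x : ZLat d} (hΓ : 0 ≤ Γ k) (hγ : 0 ≤ γ k)
    (h : ∀ y, (D1 x y : ℝ) ≤ Γ k + γ k → (y ∈ B ↔ y ∈ B')) (hx : gentleOn Γ γ B k x) :
    gentleOn Γ γ B' k x := by
  obtain ⟨h1, h2, h3⟩ := hx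
  have hball : ∀ u ∈ ball1 x (Γ k) ∩ B', u ∈ ball1 x (Γ k) ∩ B := fun u hu =>
    ⟨hu.1, (h u (by have : (D1 x u : ℝ) ≤ Γ k := hu.1; linarith)).2 hu.2⟩
  refine ⟨(h x (by simp [D1]; positivity)).1 h1,
    fun u hu v hv => h2 u (hball u hu) v (hball v hv), fun u hu v hv => ?_⟩
  by_contra! hle
  have hxu : (D1 x u : ℝ) ≤ Γ k := hu.1
  have hvB := (h v (by linarith [D1_triangle_real x u v])).2 hv.1
  exact absurd (h3 u (hball u hu) v ⟨hvB, fun hv' => hv.2 ⟨hv'.1, hv.1⟩⟩) (not_lt.2 hle)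

lemma theta_succ (Γ γ : ℕ → ℝ) (k : ℕ) :
    theta Γ γ (k + 1) = theta Γ γ k + (Γ (k + 1) + γ (k + 1)) :=
  Finset.sum_range_succ _ _

namespace ModSteep

lemma Gamma_nonneg (hs : ModSteep d Γ γ a ε) (k : ℕ) : 0 ≤ Γ k :=
  hs.gammaBigZero ▸ hs.gammaBigMono.monotone (Nat.zero_le k)

lemma gamma_nonneg (hs : ModSteep d Γ γ a ε) (k : ℕ) : 0 ≤ γ k :=
  hs.gammaSmallZero.trans (hs.gammaSmallMono.monotone (Nat.zero_le k))

lemma theta_nonneg (hs : ModSteep d Γ γ a ε) (k : ℕ) : 0 ≤ theta Γ γ k :=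
  Finset.sum_nonneg fun i _ => add_nonneg (hs.Gamma_nonneg i) (hs.gamma_nonneg i)

lemma two_le_Gamma_succ (hs : ModSteep d Γ γ a ε) (k : ℕ) : 2 ≤ Γ (k + 1) :=
  hs.gammaBigOne.trans (hs.gammaBigMono.monotone (by omega))

end ModSteep

lemma mem_badSet_congr (ω τ : DConf d) (hs : ModSteep d Γ γ a ε) (k : ℕ) :
    ∀ x : ZLat d, (∀ y, (D1 x y : ℝ) ≤ theta Γ γ k → ω y = τ y) →
      (x ∈ badSet Γ γ ω k ↔ x ∈ badSet Γ γ τ k) := by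
  induction k with
  | zero =>
    intro x h
    have : ω x = τ x := h x (by simpa [D1] using hs.theta_nonneg 0)
    simp [badSet, this]
  | succ k ih =>
    intro x h
    have hΓ := hs.Gamma_nonneg (k + 1)
    have hγ := hs.gamma_nonneg (k + 1)
    have key : ∀ y, (D1 x y : ℝ) ≤ Γ (k + 1) + γ (k + 1) →
        (y ∈ badSet Γ γ ω k ↔ y ∈ badSet Γ γ τ k) := fun y hy =>
      ih y fun z hz => h z (by rw [theta_succ]; linarith [D1_triangle_real x y z])
    have h1 := key x (by simp [D1]; positivity)
    have h2 : gentleOn Γ γ (badSet Γ γ ω k) (k + 1) x ↔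
        gentleOn Γ γ (badSet Γ γ τ k) (k + 1) x :=
      ⟨fun hx => hx.congr hΓ hγ key, fun hx => hx.congr hΓ hγ fun y hy => (key y hy).symm⟩
    simp only [badSet, Set.mem_ofPred_eq, h1, h2]

lemma eventOn_mem_badSet (hs : ModSteep d Γ γ a ε) (k : ℕ) (x : ZLat d) :
    EventOn {ω : DConf d | x ∈ badSet Γ γ ω k} (ballFin x (theta Γ γ k)) := fun σ τ h hσ =>
  (mem_badSet_congr σ τ hs k x fun y hy =>
    h y ((mem_ballFin (hs.theta_nonneg k)).2 hy)).1 hσ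

/-- The sites that may prevent a bad site `x` from being gentle at the next level. -/
def annulus (Γ γ : ℕ → ℝ) (k : ℕ) (x : ZLat d) : Finset (ZLat d) :=
  {y ∈ ballFin x (theta Γ γ k) | Γ k / 2 < D1 x y}

lemma exists_mem_annulus (hs : ModSteep d Γ γ a ε) {ω : DConf d} {k : ℕ} {x : ZLat d}
    (hx : x ∈ badSet Γ γ ω (k + 1)) :
    x ∈ badSet Γ γ ω k ∧ ∃ y ∈ annulus Γ γ (k + 1) x, y ∈ badSet Γ γ ω k := by
  obtain ⟨hxB, hxg⟩ := hx
  refine ⟨hxB, ?_⟩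
  have hΓ := hs.two_le_Gamma_succ k
  have hγ := hs.gamma_nonneg (k + 1)
  have hθ := hs.theta_nonneg k
  have mem : ∀ y, Γ (k + 1) / 2 < D1 x y → (D1 x y : ℝ) ≤ Γ (k + 1) + γ (k + 1) →
      y ∈ annulus Γ γ (k + 1) x := fun y h1 h2 =>
    Finset.mem_filter.2 ⟨(mem_ballFin (hs.theta_nonneg _)).2 (by rw [theta_succ]; linarith), h1⟩
  by_contra! hcon
  refine hxg ⟨hxB, fun u hu v hv => ?_, fun u hu v hv => ?_⟩
  · have near : ∀ w ∈ ball1 x (Γ (k + 1)) ∩ badSet Γ γ ω k, (D1 x w : ℝ) ≤ Γ (k + 1) / 2 := by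
      intro w hw
      by_contra! hlt
      have hw1 : (D1 x w : ℝ) ≤ Γ (k + 1) := hw.1
      exact hcon w (mem w hlt (by linarith)) hw.2
    have := near u hu
    rw [D1_comm] at this
    linarith [near v hv, D1_triangle_real u x v]
  · by_contra! hle
    have hxu : (D1 x u : ℝ) ≤ Γ (k + 1) := hu.1
    have hxv : Γ (k + 1) < (D1 x v : ℝ) := by
      by_contra! hle'
      exact hv.2 ⟨hle', hv.1⟩
    exact hcon v (mem v (by linarith) (by linarith [D1_triangle_real x u v])) hv.1

/-- The recursive estimate for the probability of being bad. -/
lemma real_badSet_le (hs : ModSteep d Γ γ a ε) (Q : Measure (DConf d)) [IsProbabilityMeasure Q]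
    {b'' B'' : ℝ} (hb : 0 < b'') (hB : 0 < B'') (hQ : Smin Q b'' B'')
    (hp : ∀ x : ZLat d,
      Q {ω | ω x = true} ≤ ENNReal.ofReal (Real.exp (-a / (1 - ε))))
    (hgag : ∀ k : ℕ,
      2 * 9 ^ d * B'' * theta Γ γ (k + 1) ^ (2 * d) *
          Real.exp (-b'' * Γ (k + 1) / 20) ≤
        Real.exp (-(a / (1 - ε)) * (1 + ε) ^ (k + 1))) (k : ℕ) :
    ∀ x : ZLat d, Q.real {ω : DConf d | x ∈ badSet Γ γ ω k} ≤
      Real.exp (-(a / (1 - ε)) * (1 + ε) ^ k) := by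
  classical
  induction k with
  | zero =>
    intro x
    refine ENNReal.toReal_le_of_le_ofReal (Real.exp_pos _).le ((hp x).trans (le_of_eq ?_))
    simp [neg_div]
  | succ k ih =>
    intro x
    set q : ℝ := Real.exp (-(a / (1 - ε)) * (1 + ε) ^ k) with hq
    set q' : ℝ := Real.exp (-(a / (1 - ε)) * (1 + ε) ^ (k + 1)) with hq'
    set L : ℝ := b'' * Γ (k + 1) with hL
    set M : ℝ := (2 * theta Γ γ k + 1) ^ d with hM
    set N : ℝ := (3 * theta Γ γ (k + 1)) ^ d with hN
    have hΓ := hs.two_le_Gamma_succ k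
    have hhalf := hs.halfLt (k + 1) (by omega)
    have hlam := hs.lam k
    have hθ := hs.theta_nonneg k
    have hθs := theta_succ Γ γ k
    have hθ1 : 0 ≤ theta Γ γ (k + 1) := hs.theta_nonneg (k + 1)
    have hq0 : 0 < q := Real.exp_pos _
    have hL0 : 0 ≤ L := by positivity
    have hM1 : 1 ≤ M := one_le_pow₀ (by linarith)
    have hN1 : 1 ≤ N := one_le_pow₀ (by linarith)
    have hMN : M ≤ N := pow_le_pow_left₀ (by linarith) (by linarith) d
    set E : Set (DConf d) := {ω | x ∈ badSet Γ γ ω k} with hE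
    set F : Set (DConf d) := {ω | ∃ y ∈ annulus Γ γ (k + 1) x, y ∈ badSet Γ γ ω k} with hF
    have hEloc : EventOn E (ballFin x (theta Γ γ k)) := eventOn_mem_badSet hs k x
    have hFloc : EventOn F
        ((annulus Γ γ (k + 1) x).biUnion fun y => ballFin y (theta Γ γ k)) := by
      rintro σ τ h ⟨y, hy, hσ⟩
      exact ⟨y, hy, eventOn_mem_badSet hs k y σ τ
        (fun z hz => h z (Finset.mem_biUnion.2 ⟨y, hy, hz⟩)) hσ⟩
    have hFq : Q.real F ≤ N * q := by
      have hFU : F = ⋃ y ∈ annulus Γ γ (k + 1) x, {ω | y ∈ badSet Γ γ ω k} := by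
        ext ω; simp [hF]
      have hcard : ((annulus Γ γ (k + 1) x).card : ℝ) ≤ N := by
        calc ((annulus Γ γ (k + 1) x).card : ℝ) ≤ ((ballFin x (theta Γ γ (k + 1))).card : ℝ) := by
              exact_mod_cast Finset.card_filter_le _ _
          _ ≤ (2 * theta Γ γ (k + 1) + 1) ^ d := card_ballFin_le x hθ1
          _ ≤ N := pow_le_pow_left₀ (by linarith) (by linarith) d
      calc Q.real F ≤ ∑ y ∈ annulus Γ γ (k + 1) x, Q.real {ω | y ∈ badSet Γ γ ω k} := by
            rw [hFU]; exact measureReal_biUnion_finset_le _ _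
        _ ≤ ∑ _y ∈ annulus Γ γ (k + 1) x, q := Finset.sum_le_sum fun y _ => ih y
        _ = (annulus Γ γ (k + 1) x).card * q := by simp
        _ ≤ N * q := by gcongr
    have hdist : ∀ u ∈ ballFin x (theta Γ γ k),
        ∀ v ∈ (annulus Γ γ (k + 1) x).biUnion fun y => ballFin y (theta Γ γ k),
        3 * Γ (k + 1) / 10 ≤ (D1 u v : ℝ) := by
      intro u hu v hv
      obtain ⟨y, hy, hv⟩ := Finset.mem_biUnion.1 hv
      have h1 := (mem_ballFin hθ).1 hu
      have h2 := (mem_ballFin hθ).1 hv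
      have h3 := (Finset.mem_filter.1 hy).2
      have h4 := D1_triangle_real x u y
      have h5 := D1_triangle_real u v y
      rw [D1_comm v y] at h5
      linarith
    have hmain := hQ.real_inter_le hb hB hEloc hFloc (card_ballFin_le x hθ) hdist
    have hsub : Q.real {ω : DConf d | x ∈ badSet Γ γ ω (k + 1)} ≤ Q.real (E ∩ F) :=
      measureReal_mono fun ω hω => exists_mem_annulus hs hω
    have hprod : Q.real E * Q.real F ≤ q' / 2 := by
      have h1 : 2 * N ≤ Real.exp (a * (1 + ε) ^ k) := by
        rw [hN, mul_pow, ← mul_assoc]; exact hs.growth k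
      have h2 : Real.exp (a * (1 + ε) ^ k) * q * q = q' := by
        rw [hq, hq', ← Real.exp_add, ← Real.exp_add]
        congr 1
        have : 1 - ε ≠ 0 := by linarith [hs.epsMem.2]
        field_simp
        ring
      calc Q.real E * Q.real F ≤ q * (N * q) := by
            gcongr
            exact ih x
        _ ≤ q' / 2 := by nlinarith [mul_pos hq0 hq0]
    have hexp : Real.exp (-b'' * (3 * Γ (k + 1) / 10)) ≤ Real.exp (-b'' * Γ (k + 1) / 20) :=
      Real.exp_le_exp.2 (by linarith)
    have hgag' : 2 * N ^ 2 * B'' * Real.exp (-b'' * Γ (k + 1) / 20) ≤ q' := by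
      refine le_trans (le_of_eq ?_) (hgag k)
      rw [hN, mul_pow, mul_pow, ← pow_mul, ← pow_mul, mul_comm d 2, pow_mul (3 : ℝ) 2 d]
      norm_num
      ring
    have herr : (if M * Real.exp (-b'' * (3 * Γ (k + 1) / 10)) ≤ 1 then
        B'' * (M * Real.exp (-b'' * (3 * Γ (k + 1) / 10))) else 2 * B'' * M) ≤ q' / 2 := by
      split_ifs with h
      · have hMN2 : M ≤ N ^ 2 := by nlinarith
        have : B'' * (M * Real.exp (-b'' * (3 * Γ (k + 1) / 10))) ≤
            B'' * (N ^ 2 * Real.exp (-b'' * Γ (k + 1) / 20)) := by gcongr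
        linarith
      · push Not at h
        have hd : d ≠ 0 := by
          rintro rfl
          have : Real.exp (-b'' * (3 * Γ (k + 1) / 10)) ≤ 1 :=
            Real.exp_le_one_iff.2 (by linarith)
          simp only [hM, pow_zero, one_mul] at h
          linarith
        have h2MN : 2 * M ≤ N := by
          have h2d : (2 : ℝ) ≤ 2 ^ d := le_self_pow₀ one_le_two hd
          calc 2 * M ≤ 2 ^ d * M := by gcongr
            _ = (2 * (2 * theta Γ γ k + 1)) ^ d := by rw [mul_pow]
            _ ≤ N := pow_le_pow_left₀ (by linarith) (by linarith) d
        have h3 : 1 ≤ M * Real.exp (-b'' * Γ (k + 1) / 20) :=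
          h.le.trans (by gcongr)
        have h4 : 2 * M ≤ N ^ 2 * Real.exp (-b'' * Γ (k + 1) / 20) := by
          calc 2 * M ≤ 4 * M * (M * Real.exp (-b'' * Γ (k + 1) / 20)) := by nlinarith
            _ = (2 * M) ^ 2 * Real.exp (-b'' * Γ (k + 1) / 20) := by ring
            _ ≤ _ := by gcongr
        nlinarith
    linarith

end BadSets

/-- Almost surely every site is eventually gentle. Under the hypotheses
of the gentle-disintegration theorem, `Q(⋂_k B_k = ∅) = 1`, i.e. `Q`-almost surely
every site belongs to some `G_j(ω)` and `⋃_j 𝒢_j(ω)` is a partition of `ℤ^d`. -/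
theorem stmt10 {d : ℕ} (Γ γ : ℕ → ℝ) (a ε : ℝ) (hs : ModSteep d Γ γ a ε)
    (Q : Measure (DConf d)) [IsProbabilityMeasure Q]
    (b'' B'' : ℝ) (hb : 0 < b'') (hB : 0 < B'') (hQ : Smin Q b'' B'')
    (hp : ∀ x : ZLat d,
      Q {ω | ω x = true} ≤ ENNReal.ofReal (Real.exp (-a / (1 - ε))))
    (hgag : ∀ k : ℕ,
      2 * 9 ^ d * B'' * theta Γ γ (k + 1) ^ (2 * d) *
          Real.exp (-b'' * Γ (k + 1) / 20) ≤
        Real.exp (-(a / (1 - ε)) * (1 + ε) ^ (k + 1))) :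
    Q {ω : DConf d | (⋂ k : ℕ, badSet Γ γ ω k) = ∅} = 1 := by
  have hb1 := real_badSet_le hs Q hb hB hQ hp hgag
  have hε := hs.epsMem
  have hlim : Filter.Tendsto (fun k : ℕ => Real.exp (-(a / (1 - ε)) * (1 + ε) ^ k))
      Filter.atTop (nhds 0) := by
    refine Real.tendsto_exp_atBot.comp ?_
    refine Filter.Tendsto.const_mul_atTop_of_neg ?_
      (tendsto_pow_atTop_atTop_of_one_lt (by linarith [hε.1]))
    have : 0 < a / (1 - ε) := div_pos hs.apos (by linarith [hε.2])
    linarith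
  have hnull : ∀ x : ZLat d, Q {ω : DConf d | x ∈ ⋂ k, badSet Γ γ ω k} = 0 := by
    intro x
    have h : Q.real {ω : DConf d | x ∈ ⋂ k, badSet Γ γ ω k} ≤ 0 :=
      ge_of_tendsto' hlim fun k =>
        (measureReal_mono (s₂ := {ω : DConf d | x ∈ badSet Γ γ ω k})
          fun ω (hω : x ∈ ⋂ k, badSet Γ γ ω k) => by
            exact Set.mem_iInter.1 hω k).trans (hb1 k x)
    exact (measureReal_eq_zero_iff).1 (le_antisymm h measureReal_nonneg)
  have hae : ∀ᵐ ω ∂Q, ∀ x : ZLat d, x ∉ ⋂ k, badSet Γ γ ω k := by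
    refine ae_all_iff.2 fun x => ?_
    rw [ae_iff]
    simpa using hnull x
  have huniv : {ω : DConf d | (⋂ k : ℕ, badSet Γ γ ω k) = ∅} =ᵐ[Q] Set.univ := by
    rw [Filter.eventuallyEq_univ]
    filter_upwards [hae] with ω hω
    exact Set.eq_empty_iff_forall_notMem.2 hω
  rw [measure_congr huniv, measure_univ]

end

end Paper
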